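/- arXiv:2410.01025 — 2 statements merged into one kernel-verified Lean document; each statement's English description precedes it below -/
import Mathlib

section
/- For β = 2 there exist C > 0 and λ₀ ∈ (0,1/2) such that for all λ ∈ (0,λ₀) and all integers N ≥ 1, log Z_{N,2}^λ ≥ 2N log N + N log|log λ| + N(log 2π − 1) − C N / |log λ|. -/
open MeasureTheory Real
open scoped ENNReal NNReal BigOperators Classical

noncomputable section

/-- The plane `ℝ²`. -/
abbrev E2 := EuclideanSpace ℝ (Fin 2)

/-- The logarithmic Coulomb kernel `g(x) = -log |x|`. -/
def gfun (x : E2) : ℝ := -Real.log ‖x‖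

/-- The uniform probability measure on the closed ball `B(z, lam)` (smeared charge). -/
def udisc (z : E2) (lam : ℝ) : MeasureTheory.Measure E2 :=
  (MeasureTheory.volume (Metric.closedBall z lam))⁻¹ •
    MeasureTheory.volume.restrict (Metric.closedBall z lam)

/-- The smeared interaction `g_lam(z) = ∬ g(x-y) dδ_0^{(lam)}(x) dδ_z^{(lam)}(y)`. -/
def gsm (lam : ℝ) (z : E2) : ℝ :=
  ∫ x, (∫ y, gfun (x - y) ∂(udisc z lam)) ∂(udisc 0 lam)

/-- `κ = g_1(0)`. -/
def kappa : ℝ := gsm 1 0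

/-- The (renormalized) energy `F_lam(X_N, Y_N)`. -/
def Flam (N : ℕ) (lam : ℝ) (X Y : Fin N → E2) : ℝ :=
  (1/2) * (∑ i : Fin N, ∑ j : Fin N,
      (gsm lam (X i - X j) + gsm lam (Y i - Y j) - 2 * gsm lam (X i - Y j)))
    - N * (-Real.log lam + kappa)

/-- The box `Λ = [0, √N]²`. -/
def LamBox (N : ℕ) : Set E2 := {x | ∀ i, x i ∈ Set.Icc (0:ℝ) (Real.sqrt N)}

/-- The configuration space `Λ^N × Λ^N`. -/
def confSet (N : ℕ) : Set ((Fin N → E2) × (Fin N → E2)) :=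
  {P | (∀ i, P.1 i ∈ LamBox N) ∧ (∀ i, P.2 i ∈ LamBox N)}

/-- The partition function `Z_{N,β}^{lam}`. -/
def Zpart (N : ℕ) (β lam : ℝ) : ℝ :=
  ∫ P in confSet N, Real.exp (-β * Flam N lam P.1 P.2)

/-- `g_1` evaluated at (any) point of norm `r` (it is radial). -/
def g1rad (r : ℝ) : ℝ := gsm 1 (EuclideanSpace.single (0 : Fin 2) r)

/-- The constant `𝒵_β`. -/
def Zbeta (β : ℝ) : ℝ :=
  if β = 2 then 2 * Real.pi
  else 2 * Real.pi * ∫ r in Set.Ioi (0:ℝ), Real.exp (β * g1rad r) * r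

/-- The error rate `ω_lam` (with `M₀ = 36`). -/
def omegaL (β lam : ℝ) : ℝ :=
  if β = 2 then |Real.log lam| ^ (-(1:ℝ)/(5+36))
  else if β < 4 then lam ^ ((2*(β-2))/(12-β+36))
  else if β = 4 then (lam * |Real.log lam|) ^ ((1:ℝ)/(2+36))
  else lam ^ ((1:ℝ)/(2+36))

theorem norm_sub_le_of_mem_closedBall {a y : E2} (hy : y ∈ Metric.closedBall (0 : E2) 1) :
    ‖a - y‖ ≤ ‖a‖ + 1 :=
  (norm_sub_le a y).trans (by simpa using hy)

theorem volume_unit_closedBall : volume (Metric.closedBall (0 : E2) 1) = ENNReal.ofReal π := by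
  rw [EuclideanSpace.volume_closedBall_fin_two]
  simp [ENNReal.ofReal]

instance isProbabilityMeasure_udisc_unit : IsProbabilityMeasure (udisc 0 1) := by
  constructor
  have h : volume (Metric.closedBall (0 : E2) 1) ≠ 0 := by
    rw [volume_unit_closedBall]; simp [pi_pos]
  rw [udisc, Measure.smul_apply, Measure.restrict_apply_univ, smul_eq_mul,
    ENNReal.inv_mul_cancel h measure_closedBall_lt_top.ne]

theorem integral_udisc {lam : ℝ} (hl : 0 < lam) (z : E2) (f : E2 → ℝ) :
    ∫ y, f y ∂(udisc z lam) = ∫ u, f (z + lam • u) ∂(udisc 0 1) := by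
  have h1 : ∫ u in Metric.closedBall (0 : E2) 1, f (z + lam • u)
      = (lam ^ 2)⁻¹ * ∫ y in Metric.closedBall z lam, f y := by
    rw [Measure.setIntegral_comp_smul_of_pos volume (fun v => f (z + v)) _ hl,
      smul_closedBall _ _ zero_le_one]
    have h2 := (measurePreserving_add_left (volume : Measure E2) z).setIntegral_preimage_emb
      (measurableEmbedding_addLeft z) f (Metric.closedBall z lam)
    rw [← h2, Real.norm_of_nonneg hl.le]
    simp
  have h3 : volume (Metric.closedBall z lam)
      = ENNReal.ofReal (lam ^ 2) * volume (Metric.closedBall (0 : E2) 1) := by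
    rw [Measure.addHaar_closedBall' _ _ hl.le]; simp
  simp only [udisc, integral_smul_measure, h1, h3]
  have h4 : (ENNReal.ofReal (lam ^ 2)).toReal = lam ^ 2 := ENNReal.toReal_ofReal (sq_nonneg _)
  simp only [ENNReal.toReal_inv, ENNReal.toReal_mul, h4, smul_eq_mul, mul_inv]
  ring

theorem ae_ne_udisc (a : E2) : ∀ᵐ y ∂(udisc 0 1), y ≠ a := by
  refine Measure.ae_smul_measure ?_ _
  exact ae_restrict_of_ae (Measure.ae_ne volume a)

theorem ae_mem_udisc : ∀ᵐ y ∂(udisc 0 1), y ∈ Metric.closedBall (0 : E2) 1 := by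
  refine Measure.ae_smul_measure ?_ _
  exact ae_restrict_mem Metric.isClosed_closedBall.measurableSet

theorem measurable_gfun : Measurable gfun := by
  unfold gfun; fun_prop

theorem integrableOn_gfun_ball (r : ℝ) : IntegrableOn gfun (Metric.ball (0 : E2) r) := by
  unfold gfun
  rw [integrableOn_fun_norm_addHaar volume (f := fun t => -Real.log t)]
  have : IntegrableOn (fun t : ℝ => -Real.log t) (Set.Ioo 0 r) := by
    rcases le_or_gt r 0 with h | h
    · simp [Set.Ioo_eq_empty_of_le h]
    · have := (intervalIntegral.intervalIntegrable_log' (a := 0) (b := r)).neg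
      rw [intervalIntegrable_iff_integrableOn_Ioo_of_le h.le] at this
      exact this
  refine (this.bdd_mul (c := |r|) (f := fun y : ℝ => y ^ (Module.finrank ℝ E2 - 1))
    (by fun_prop) ?_)
  refine (ae_restrict_mem measurableSet_Ioo).mono fun y hy => ?_
  simp only [finrank_euclideanSpace, Fintype.card_fin]
  norm_num
  rw [abs_of_pos hy.1, abs_of_pos (hy.1.trans hy.2)]
  exact hy.2.le

theorem integrable_gfun_sub (a : E2) : Integrable (fun y => gfun (a - y)) (udisc 0 1) := by
  refine Integrable.smul_measure ?_ (by
    rw [volume_unit_closedBall]; simp [pi_pos])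
  have h := (Measure.measurePreserving_sub_left (volume : Measure E2) a).integrableOn_comp_preimage
    (measurableEmbedding_subLeft a) (f := gfun) (s := Metric.ball 0 (‖a‖ + 2))
  refine (h.2 (integrableOn_gfun_ball _)).mono_set ?_
  intro y hy
  have := norm_sub_le_of_mem_closedBall (a := a) hy
  simp
  linarith

/-- The logarithmic potential of the uniform measure on the unit disc. -/
def discPotential (a : E2) : ℝ := ∫ y, gfun (a - y) ∂(udisc 0 1)

theorem measurable_discPotential : Measurable discPotential := by
  refine StronglyMeasurable.measurable ?_
  refine StronglyMeasurable.integral_prod_right (f := fun a y => gfun (a - y)) ?_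
  exact (measurable_gfun.comp (measurable_fst.sub measurable_snd)).stronglyMeasurable

theorem le_discPotential (a : E2) : -Real.log (‖a‖ + 1) ≤ discPotential a := by
  have h : ∫ _y, -Real.log (‖a‖ + 1) ∂(udisc 0 1) ≤ discPotential a := by
    refine integral_mono_ae (integrable_const _) (integrable_gfun_sub a) ?_
    filter_upwards [ae_ne_udisc a, ae_mem_udisc] with y h1 h2
    simp only [gfun]
    have h3 : 0 < ‖a - y‖ := norm_pos_iff.2 (sub_ne_zero.2 (Ne.symm h1))
    have := Real.log_le_log h3 (norm_sub_le_of_mem_closedBall (a := a) h2)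
    linarith
  simpa using h

theorem exists_discPotential_le : ∃ K : ℝ, ∀ a, discPotential a ≤ K := by
  set φ : E2 → ℝ := (Metric.ball (0 : E2) 1).indicator gfun with hφ
  have hφi : Integrable φ :=
    (integrable_indicator_iff measurableSet_ball).2 (integrableOn_gfun_ball 1)
  have hφ0 : ∀ x, 0 ≤ φ x := by
    intro x
    refine Set.indicator_nonneg (fun y hy => ?_) x
    simp only [gfun]
    have : ‖y‖ < 1 := by simpa using hy
    have := Real.log_nonpos (norm_nonneg y) this.le
    linarith
  have hle : ∀ x, gfun x ≤ φ x := by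
    intro x
    by_cases hx : x ∈ Metric.ball (0 : E2) 1
    · simp [hφ, hx]
    · simp only [hφ, Set.indicator_of_notMem hx, gfun]
      have : 1 ≤ ‖x‖ := by simpa using hx
      have := Real.log_nonneg this
      linarith
  refine ⟨(volume (Metric.closedBall (0 : E2) 1))⁻¹.toReal * ∫ x, φ x, fun a => ?_⟩
  have hi : Integrable (fun y => φ (a - y)) := hφi.comp_sub_left a
  have hi' : Integrable (fun y => φ (a - y)) (udisc 0 1) :=
    Integrable.smul_measure hi.integrableOn (by rw [volume_unit_closedBall]; simp [pi_pos])
  calc discPotential a ≤ ∫ y, φ (a - y) ∂(udisc 0 1) :=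
        integral_mono (integrable_gfun_sub a) hi' fun y => hle _
    _ = (volume (Metric.closedBall (0 : E2) 1))⁻¹.toReal *
          ∫ y in Metric.closedBall (0 : E2) 1, φ (a - y) := by
        rw [udisc, integral_smul_measure, smul_eq_mul]
    _ ≤ (volume (Metric.closedBall (0 : E2) 1))⁻¹.toReal * ∫ y, φ (a - y) :=
        mul_le_mul_of_nonneg_left
          (setIntegral_le_integral hi (Filter.Eventually.of_forall fun y => hφ0 _))
          ENNReal.toReal_nonneg
    _ = _ := by rw [integral_sub_left_eq_self]

theorem integrable_discPotential (z : E2) :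
    Integrable (fun x => discPotential (x - z)) (udisc 0 1) := by
  obtain ⟨K, hK⟩ := exists_discPotential_le
  refine Integrable.of_bound
    (measurable_discPotential.comp (measurable_id.sub_const z)).aestronglyMeasurable
    (max K (Real.log (‖z‖ + 2))) ?_
  filter_upwards [ae_mem_udisc] with x hx
  rw [Real.norm_eq_abs, abs_le']
  refine ⟨(hK _).trans (le_max_left _ _), le_trans ?_ (le_max_right _ _)⟩
  have h1 := le_discPotential (x - z)
  have h2 : ‖x - z‖ + 1 ≤ ‖z‖ + 2 := by
    have := norm_sub_le_of_mem_closedBall (a := z) hx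
    rw [norm_sub_rev]; linarith
  have := Real.log_le_log (by positivity) h2
  linarith

theorem gsm_eq {lam : ℝ} (hl : 0 < lam) (z : E2) :
    gsm lam z = -Real.log lam + ∫ x, discPotential (x - lam⁻¹ • z) ∂(udisc 0 1) := by
  have key : ∀ x : E2, ∫ y, gfun (0 + lam • x - (z + lam • y)) ∂(udisc 0 1)
      = -Real.log lam + discPotential (x - lam⁻¹ • z) := by
    intro x
    have : ∫ y, gfun (0 + lam • x - (z + lam • y)) ∂(udisc 0 1)
        = ∫ y, (-Real.log lam + gfun (x - lam⁻¹ • z - y)) ∂(udisc 0 1) := by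
      refine integral_congr_ae ?_
      filter_upwards [ae_ne_udisc (x - lam⁻¹ • z)] with y hy
      have h1 : 0 + lam • x - (z + lam • y) = lam • (x - lam⁻¹ • z - y) := by
        rw [smul_sub, smul_sub, smul_inv_smul₀ hl.ne']; abel
      have h2 : ‖x - lam⁻¹ • z - y‖ ≠ 0 := norm_ne_zero_iff.2 (sub_ne_zero.2 (Ne.symm hy))
      rw [h1, gfun, gfun, norm_smul, Real.norm_eq_abs, abs_of_pos hl, Real.log_mul hl.ne' h2]
      ring
    rw [this, integral_add (integrable_const _) (integrable_gfun_sub _)]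
    simp [discPotential]
  rw [gsm, integral_udisc hl]
  simp only [integral_udisc hl z, key]
  rw [integral_add (integrable_const _) (integrable_discPotential _)]
  simp

theorem gsm_zero {lam : ℝ} (hl : 0 < lam) : gsm lam 0 = -Real.log lam + kappa := by
  rw [kappa, gsm_eq hl, gsm_eq one_pos]
  simp

theorem measurable_gsm {lam : ℝ} (hl : 0 < lam) : Measurable (gsm lam) := by
  have : gsm lam = fun z => -Real.log lam + ∫ x, discPotential (x - lam⁻¹ • z) ∂(udisc 0 1) :=
    funext (gsm_eq hl)
  rw [this]
  refine measurable_const.add (StronglyMeasurable.measurable ?_)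
  refine StronglyMeasurable.integral_prod_right
    (f := fun z x => discPotential (x - lam⁻¹ • z)) ?_
  refine (measurable_discPotential.comp ?_).stronglyMeasurable
  fun_prop

theorem le_gsm {lam : ℝ} (hl : 0 < lam) (z : E2) : -Real.log (‖z‖ + 2 * lam) ≤ gsm lam z := by
  have h : ∫ _x, -Real.log (‖lam⁻¹ • z‖ + 2) ∂(udisc 0 1)
      ≤ ∫ x, discPotential (x - lam⁻¹ • z) ∂(udisc 0 1) := by
    refine integral_mono_ae (integrable_const _) (integrable_discPotential _) ?_
    filter_upwards [ae_mem_udisc] with x hx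
    refine le_trans ?_ (le_discPotential _)
    have h2 : ‖x - lam⁻¹ • z‖ + 1 ≤ ‖lam⁻¹ • z‖ + 2 := by
      have := norm_sub_le_of_mem_closedBall (a := lam⁻¹ • z) hx
      rw [norm_sub_rev]; linarith
    exact neg_le_neg (Real.log_le_log (by positivity) h2)
  have h3 : ‖z‖ + 2 * lam = lam * (‖lam⁻¹ • z‖ + 2) := by
    rw [norm_smul, norm_inv, Real.norm_eq_abs, abs_of_pos hl]
    field_simp
  rw [gsm_eq hl, h3, Real.log_mul hl.ne' (by positivity)]
  simp at h ⊢
  linarith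

theorem exists_gsm_le {lam : ℝ} (hl : 0 < lam) : ∃ K : ℝ, ∀ z, gsm lam z ≤ K := by
  obtain ⟨K, hK⟩ := exists_discPotential_le
  refine ⟨-Real.log lam + K, fun z => ?_⟩
  rw [gsm_eq hl]
  have := integral_mono (integrable_discPotential (lam⁻¹ • z)) (integrable_const K) fun x => hK _
  simp at this ⊢
  linarith

/-- Configurations of `N` positive and `N` negative charges. -/
abbrev Conf (N : ℕ) := (Fin N → E2) × (Fin N → E2)

/-- Exchange the two charges of each dipole `(P.1 i, P.2 i)` selected by `S`. -/
def flipConf {N : ℕ} (S : Fin N → Bool) (P : Conf N) : Conf N :=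
  (fun i => bif S i then P.2 i else P.1 i, fun i => bif S i then P.1 i else P.2 i)

/-- Toggle the `j`-th sign. -/
def toggle {N : ℕ} (j : Fin N) : Equiv.Perm (Fin N → Bool) :=
  Function.Involutive.toPerm (fun S => Function.update S j (!S j)) fun S => by simp

theorem toggle_self {N : ℕ} (j : Fin N) (S : Fin N → Bool) : toggle j S j = !S j := by
  exact Function.update_self ..

theorem toggle_of_ne {N : ℕ} {i j : Fin N} (h : i ≠ j) (S : Fin N → Bool) :
    toggle j S i = S i := by
  exact Function.update_of_ne h ..

theorem sum_flipConf_interaction_eq_zero {N : ℕ} (G : E2 → ℝ) (P : Conf N) {i j : Fin N}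
    (h : i ≠ j) :
    ∑ S : Fin N → Bool, (G ((flipConf S P).1 i - (flipConf S P).1 j)
      + G ((flipConf S P).2 i - (flipConf S P).2 j)
      - 2 * G ((flipConf S P).1 i - (flipConf S P).2 j)) = 0 := by
  have h1 : ∑ S : Fin N → Bool, G ((flipConf S P).1 i - (flipConf S P).1 j)
      = ∑ S : Fin N → Bool, G ((flipConf S P).1 i - (flipConf S P).2 j) := by
    rw [← Equiv.sum_comp (toggle j)]
    refine Finset.sum_congr rfl fun S _ => ?_
    simp only [flipConf, toggle_self, toggle_of_ne h, Bool.cond_not]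
  have h2 : ∑ S : Fin N → Bool, G ((flipConf S P).2 i - (flipConf S P).2 j)
      = ∑ S : Fin N → Bool, G ((flipConf S P).1 i - (flipConf S P).2 j) := by
    rw [← Equiv.sum_comp (toggle i)]
    refine Finset.sum_congr rfl fun S _ => ?_
    simp only [flipConf, toggle_self, toggle_of_ne h.symm, Bool.cond_not]
  rw [Finset.sum_sub_distrib, Finset.sum_add_distrib, ← Finset.mul_sum, h1, h2]
  ring

theorem card_signs (N : ℕ) : (Finset.univ : Finset (Fin N → Bool)).card = 2 ^ N := by simp

theorem le_sum_neg_two_mul_Flam_flipConf {N : ℕ} {lam : ℝ} (hl : 0 < lam) (P : Conf N) :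
    2 ^ N * ∑ i, -2 * Real.log (dist (P.1 i) (P.2 i) + 2 * lam)
      ≤ ∑ S : Fin N → Bool, -2 * Flam N lam (flipConf S P).1 (flipConf S P).2 := by
  set T : (Fin N → Bool) → Fin N → Fin N → ℝ := fun S i j =>
    gsm lam ((flipConf S P).1 i - (flipConf S P).1 j)
      + gsm lam ((flipConf S P).2 i - (flipConf S P).2 j)
      - 2 * gsm lam ((flipConf S P).1 i - (flipConf S P).2 j) with hT
  have hF : ∀ S, -2 * Flam N lam (flipConf S P).1 (flipConf S P).2
      = -(∑ i, ∑ j, T S i j) + 2 * N * gsm lam 0 := by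
    intro S
    rw [Flam, gsm_zero hl]
    ring
  have hoff : ∑ S, ∑ i, ∑ j, T S i j = ∑ i, ∑ S, T S i i := by
    rw [Finset.sum_comm]
    refine Finset.sum_congr rfl fun i _ => ?_
    rw [Finset.sum_comm]
    exact Finset.sum_eq_single i
      (fun j _ hj => sum_flipConf_interaction_eq_zero (gsm lam) P hj.symm) (by simp)
  have hdiag : ∀ S i, T S i i
      ≤ 2 * gsm lam 0 + 2 * Real.log (dist (P.1 i) (P.2 i) + 2 * lam) := by
    intro S i
    have h1 := le_gsm hl ((flipConf S P).1 i - (flipConf S P).2 i)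
    have h2 : ‖(flipConf S P).1 i - (flipConf S P).2 i‖ = dist (P.1 i) (P.2 i) := by
      cases h : S i
      · simp [flipConf, h, dist_eq_norm]
      · simp [flipConf, h, dist_eq_norm, norm_sub_rev]
    rw [h2] at h1
    simp only [hT, sub_self]
    linarith
  have hsum : ∑ i, ∑ S, T S i i ≤ ∑ i, (2 : ℝ) ^ N *
      (2 * gsm lam 0 + 2 * Real.log (dist (P.1 i) (P.2 i) + 2 * lam)) := by
    refine Finset.sum_le_sum fun i _ => ?_
    refine (Finset.sum_le_sum fun S _ => hdiag S i).trans ?_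
    rw [Finset.sum_const, card_signs, nsmul_eq_mul]
    push_cast
    exact le_rfl
  simp only [hF]
  rw [Finset.sum_add_distrib, Finset.sum_neg_distrib, hoff, Finset.sum_const, card_signs,
    nsmul_eq_mul]
  rw [← Finset.mul_sum, Finset.sum_add_distrib, Finset.sum_const, Finset.card_univ,
    Fintype.card_fin, nsmul_eq_mul, ← Finset.mul_sum] at hsum
  rw [← Finset.mul_sum]
  push_cast
  linarith

theorem two_pow_mul_prod_le_sum_exp {N : ℕ} {lam : ℝ} (hl : 0 < lam) (P : Conf N) :
    2 ^ N * ∏ i, ((dist (P.1 i) (P.2 i) + 2 * lam) ^ 2)⁻¹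
      ≤ ∑ S : Fin N → Bool, Real.exp (-2 * Flam N lam (flipConf S P).1 (flipConf S P).2) := by
  set b : ℝ := ∑ i, -2 * Real.log (dist (P.1 i) (P.2 i) + 2 * lam) with hb
  have hprod : ∏ i, ((dist (P.1 i) (P.2 i) + 2 * lam) ^ 2)⁻¹ = Real.exp b := by
    rw [hb, Real.exp_sum]
    refine Finset.prod_congr rfl fun i _ => ?_
    have : 0 < dist (P.1 i) (P.2 i) + 2 * lam := by positivity
    rw [neg_mul, Real.exp_neg, two_mul (Real.log _), Real.exp_add, Real.exp_log this, sq]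
  have hlin : ∀ S : Fin N → Bool,
      Real.exp b * (1 - b + -2 * Flam N lam (flipConf S P).1 (flipConf S P).2)
        ≤ Real.exp (-2 * Flam N lam (flipConf S P).1 (flipConf S P).2) := by
    intro S
    set a := -2 * Flam N lam (flipConf S P).1 (flipConf S P).2
    have h1 : Real.exp a = Real.exp b * Real.exp (a - b) := by rw [← Real.exp_add]; ring_nf
    rw [h1]
    have := Real.add_one_le_exp (a - b)
    exact mul_le_mul_of_nonneg_left (by linarith) (Real.exp_pos b).le
  refine le_trans ?_ (Finset.sum_le_sum fun S _ => hlin S)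
  rw [← Finset.mul_sum, Finset.sum_add_distrib, Finset.sum_const, card_signs, nsmul_eq_mul, hprod,
    mul_comm]
  refine mul_le_mul_of_nonneg_left ?_ (Real.exp_pos b).le
  have := le_sum_neg_two_mul_Flam_flipConf hl P
  push_cast
  linarith

theorem measurableSet_separated {n : ℕ} {L : Fin n → Set E2} (hL : ∀ i, MeasurableSet (L i))
    (c : Fin n → E2) (ρ : Fin n → Fin n → ℝ) :
    MeasurableSet {X : Fin n → E2 | (∀ i, X i ∈ L i) ∧
      ∀ i j, i < j → ρ i j < dist (X i + c i) (X j + c j)} := by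
  simp only [Set.ofPred_and, Set.ofPred_forall]
  refine MeasurableSet.inter
    (MeasurableSet.iInter fun i => measurable_pi_apply i (hL i))
    (MeasurableSet.iInter fun i => MeasurableSet.iInter fun j => MeasurableSet.iInter fun _ =>
      measurableSet_lt measurable_const (by fun_prop))

/-- Inserting the points one after the other, each one avoids the discs around those already
placed. -/
theorem prod_le_volume_separated : ∀ {n : ℕ} {L : Fin n → Set E2}
    (_ : ∀ i, MeasurableSet (L i)) (c : Fin n → E2) (ρ : Fin n → Fin n → ℝ) {q : Fin n → ℝ≥0∞}
    (_ : ∀ i, q i + ∑ j, volume (Metric.closedBall (0 : E2) (ρ i j)) ≤ volume (L i)),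
    ∏ i, q i ≤ volume {X : Fin n → E2 | (∀ i, X i ∈ L i) ∧
      ∀ i j, i < j → ρ i j < dist (X i + c i) (X j + c j)}
  | 0, L, _, c, ρ, q, _ => by
    have : {X : Fin 0 → E2 | (∀ i, X i ∈ L i) ∧
      ∀ i j, i < j → ρ i j < dist (X i + c i) (X j + c j)} = Set.univ := by ext; simp
    rw [this, volume_pi, Measure.pi_univ]
    simp
  | n + 1, L, hL, c, ρ, q, hq => by
    set A : Set (Fin (n + 1) → E2) := {X | (∀ i, X i ∈ L i) ∧
      ∀ i j, i < j → ρ i j < dist (X i + c i) (X j + c j)} with hA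
    set B : Set (Fin n → E2) := {X | (∀ i, X i ∈ L i.succ) ∧
      ∀ i j, i < j → ρ i.succ j.succ < dist (X i + c i.succ) (X j + c j.succ)} with hB
    have hAm : MeasurableSet A := measurableSet_separated hL c ρ
    have hBm : MeasurableSet B :=
      measurableSet_separated (fun i => hL i.succ) (fun i => c i.succ) fun i j => ρ i.succ j.succ
    have ih : ∏ i : Fin n, q i.succ ≤ volume B := by
      refine prod_le_volume_separated (fun i => hL i.succ) (fun i => c i.succ)
        (fun i j => ρ i.succ j.succ) fun i => le_trans ?_ (hq i.succ)
      rw [Fin.sum_univ_succ]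
      gcongr
      exact le_add_self
    have hslice : ∀ Y ∈ B, q 0 ≤ volume ((fun x : E2 => (x, Y)) ⁻¹'
        ((MeasurableEquiv.piFinSuccAbove (fun _ : Fin (n + 1) => E2) 0).symm ⁻¹' A)) := by
      intro Y hY
      have hsub : L 0 \ ⋃ j : Fin n, Metric.closedBall (Y j + c j.succ - c 0) (ρ 0 j.succ)
          ⊆ (fun x : E2 => (x, Y)) ⁻¹'
            ((MeasurableEquiv.piFinSuccAbove (fun _ : Fin (n + 1) => E2) 0).symm ⁻¹' A) := by
        rintro x ⟨hx, hx'⟩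
        simp only [Set.mem_iUnion, Metric.mem_closedBall, not_exists, not_le] at hx'
        have hcons : (MeasurableEquiv.piFinSuccAbove (fun _ : Fin (n + 1) => E2) 0).symm (x, Y)
            = Fin.cons x Y := by
          simp [MeasurableEquiv.piFinSuccAbove, Fin.insertNthEquiv]
        rw [Set.mem_preimage, Set.mem_preimage, hcons]
        refine ⟨fun i => ?_, fun i j hij => ?_⟩
        · refine Fin.cases ?_ (fun i => ?_) i
          · simpa using hx
          · simpa using hY.1 i
        · revert hij
          refine Fin.cases ?_ (fun j => ?_) j
          · intro h; exact absurd h (Fin.not_lt_zero i)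
          · refine Fin.cases ?_ (fun i => ?_) i
            · intro _
              simp only [Fin.cons_zero, Fin.cons_succ]
              refine (hx' j).trans_eq ?_
              rw [dist_eq_norm, dist_eq_norm]
              congr 1
              abel
            · intro hij
              simpa using hY.2 i j (Fin.succ_lt_succ_iff.1 hij)
      refine le_trans ?_ (measure_mono hsub)
      refine le_trans ?_ le_measure_sdiff
      have hU : volume (⋃ j : Fin n, Metric.closedBall (Y j + c j.succ - c 0) (ρ 0 j.succ))
          ≤ ∑ j, volume (Metric.closedBall (0 : E2) (ρ 0 j)) := by
        refine (measure_iUnion_fintype_le _ _).trans ?_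
        rw [Fin.sum_univ_succ]
        refine le_trans (le_of_eq ?_) le_add_self
        refine Finset.sum_congr rfl fun j _ => ?_
        exact Measure.addHaar_closedBall_center _ _ _
      refine le_trans ?_ (tsub_le_tsub_left hU _)
      refine ENNReal.le_sub_of_add_le_right ?_ (hq 0)
      exact (ENNReal.sum_lt_top.2 fun j _ => measure_closedBall_lt_top).ne
    have hvol : volume A = volume
        ((MeasurableEquiv.piFinSuccAbove (fun _ : Fin (n + 1) => E2) 0).symm ⁻¹' A) :=
      ((volume_preserving_piFinSuccAbove (fun _ : Fin (n + 1) => E2) 0).symm.measure_preimage_equiv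
        A).symm
    rw [hvol, Measure.volume_eq_prod, Measure.prod_apply_symm (MeasurableEquiv.measurable _ hAm),
      Fin.prod_univ_succ]
    calc q 0 * ∏ i : Fin n, q i.succ ≤ q 0 * volume B := by gcongr
      _ = ∫⁻ _ in B, q 0 := by rw [setLIntegral_const]
      _ ≤ ∫⁻ Y in B, volume ((fun x : E2 => (x, Y)) ⁻¹'
        ((MeasurableEquiv.piFinSuccAbove (fun _ : Fin (n + 1) => E2) 0).symm ⁻¹' A)) :=
        setLIntegral_mono' hBm hslice
      _ ≤ _ := setLIntegral_le_lintegral _ _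

theorem measurableSet_box (a b : ℝ) : MeasurableSet {x : E2 | ∀ k, x k ∈ Set.Icc a b} := by
  rw [Set.ofPred_forall]
  refine MeasurableSet.iInter fun k => ?_
  exact (show Measurable fun x : E2 => x k by fun_prop) measurableSet_Icc

theorem volume_box (a b : ℝ) :
    volume {x : E2 | ∀ k, x k ∈ Set.Icc a b} = ENNReal.ofReal (b - a) ^ 2 := by
  have h := (PiLp.volume_preserving_ofLp (Fin 2)).measure_preimage
    (s := Set.univ.pi fun _ : Fin 2 => Set.Icc a b)
    (MeasurableSet.univ_pi fun _ => measurableSet_Icc).nullMeasurableSet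
  rw [volume_pi_pi] at h
  simp only [Real.volume_Icc, Finset.prod_const, Finset.card_univ, Fintype.card_fin] at h
  rw [← h]
  congr 1
  ext x
  simp [Pi.le_def]
  tauto

theorem exp_neg_two_mul_le {t : ℝ} (h0 : 0 ≤ t) (h1 : t ≤ 1 / 2) : Real.exp (-(2 * t)) ≤ 1 - t := by
  rw [Real.exp_neg]
  have h2 := Real.add_one_le_exp (2 * t)
  refine (inv_anti₀ (by linarith) h2).trans ?_
  rw [inv_le_iff_one_le_mul₀ (by linarith)]
  nlinarith

/-- Radial weight of a dipole of length `r`. -/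
def dipoleWeight (lam r : ℝ) : ℝ := ((r + 2 * lam) ^ 2)⁻¹

/-- Truncated and damped radial weight of a dipole. -/
def dampedWeight (lam : ℝ) : ℝ → ℝ :=
  (Set.Iic (1 / 100)).indicator fun r => dipoleWeight lam r * Real.exp (-(12 * r))

theorem measurable_dipoleWeight (lam : ℝ) : Measurable (dipoleWeight lam) := by
  unfold dipoleWeight; fun_prop

theorem measurable_dampedWeight (lam : ℝ) : Measurable (dampedWeight lam) :=
  ((measurable_dipoleWeight lam).mul (by fun_prop)).indicator measurableSet_Iic

theorem dipoleWeight_nonneg (lam r : ℝ) : 0 ≤ dipoleWeight lam r := by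
  unfold dipoleWeight; positivity

theorem dampedWeight_nonneg (lam r : ℝ) : 0 ≤ dampedWeight lam r :=
  Set.indicator_nonneg (fun _ _ => mul_nonneg (dipoleWeight_nonneg _ _) (Real.exp_pos _).le) _

theorem dampedWeight_of_le {lam r : ℝ} (h : r ≤ 1 / 100) :
    dampedWeight lam r = dipoleWeight lam r * Real.exp (-(12 * r)) :=
  Set.indicator_of_mem (s := Set.Iic (1 / 100 : ℝ)) h _

theorem dampedWeight_of_lt {lam r : ℝ} (h : 1 / 100 < r) : dampedWeight lam r = 0 :=
  Set.indicator_of_notMem (s := Set.Iic (1 / 100 : ℝ)) (not_le.2 h) _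

theorem dampedWeight_le {lam r : ℝ} (hl : 0 < lam) (hr : 0 ≤ r) :
    dampedWeight lam r ≤ ((2 * lam) ^ 2)⁻¹ := by
  rcases le_or_gt r (1 / 100) with h | h
  · rw [dampedWeight_of_le h, ← mul_one ((2 * lam) ^ 2)⁻¹]
    refine mul_le_mul (inv_anti₀ (by positivity) ?_) (Real.exp_le_one_iff.2 (by linarith))
      (Real.exp_pos _).le (by positivity)
    gcongr
    linarith
  · rw [dampedWeight_of_lt h]; positivity

theorem integrable_dampedWeight {lam : ℝ} (hl : 0 < lam) :
    Integrable fun z : E2 => dampedWeight lam ‖z‖ := by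
  rw [← integrableOn_iff_integrable_of_support_subset
    (s := Metric.closedBall (0 : E2) (1 / 100))]
  · refine Measure.integrableOn_of_bounded (M := ((2 * lam) ^ 2)⁻¹)
      measure_closedBall_lt_top.ne
      ((measurable_dampedWeight lam).comp measurable_norm).aestronglyMeasurable ?_
    refine Filter.Eventually.of_forall fun z => ?_
    rw [Real.norm_of_nonneg (dampedWeight_nonneg _ _)]
    exact dampedWeight_le hl (norm_nonneg z)
  · intro z hz
    by_contra h
    refine hz (dampedWeight_of_lt ?_)
    simpa using h

theorem integral_dampedWeight_eq (lam : ℝ) :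
    ∫ z : E2, dampedWeight lam ‖z‖
      = 2 * π * ∫ r in (0 : ℝ)..(1 / 100), r * (dipoleWeight lam r * Real.exp (-(12 * r))) := by
  rw [integral_fun_norm_addHaar volume (dampedWeight lam)]
  have h1 : volume.real (Metric.ball (0 : E2) 1) = π := by
    rw [Measure.real, EuclideanSpace.volume_ball_fin_two]
    simp [pi_pos.le]
  have h2 : ∫ y in Set.Ioi (0 : ℝ), y ^ (Module.finrank ℝ E2 - 1) • dampedWeight lam y
      = ∫ r in (0 : ℝ)..(1 / 100), r * (dipoleWeight lam r * Real.exp (-(12 * r))) := by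
    rw [intervalIntegral.integral_of_le (by norm_num), ← Set.Ioi_inter_Iic,
      ← setIntegral_indicator measurableSet_Iic]
    refine setIntegral_congr_fun measurableSet_Ioi fun y _ => ?_
    by_cases hy : y ∈ Set.Iic (1 / 100 : ℝ)
    · simp only [dampedWeight, Set.indicator_of_mem hy]; simp
    · simp only [dampedWeight, Set.indicator_of_notMem hy]; simp
  rw [h1, h2]
  simp
  ring

theorem le_integral_dampedWeight {lam : ℝ} (hl : 0 < lam) :
    2 * π * (-Real.log lam - (Real.log 200 + 2)) ≤ ∫ z : E2, dampedWeight lam ‖z‖ := by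
  rw [integral_dampedWeight_eq]
  refine mul_le_mul_of_nonneg_left ?_ (by positivity)
  have hpos : ∀ r ∈ Set.uIcc (0 : ℝ) (1 / 100), 0 < r + 2 * lam := by
    intro r hr
    rw [Set.uIcc_of_le (by norm_num)] at hr
    linarith [hr.1]
  have hderiv : ∀ r ∈ Set.uIcc (0 : ℝ) (1 / 100),
      HasDerivAt (fun r => Real.log (r + 2 * lam) + 2 * lam * (r + 2 * lam)⁻¹ - 12 * r)
        (r * dipoleWeight lam r - 12) r := by
    intro r hr
    have h0 := (hpos r hr).ne'
    have h1 : HasDerivAt (fun r => r + 2 * lam) 1 r := (hasDerivAt_id r).add_const _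
    have h2 := ((h1.log h0).add ((h1.inv h0).const_mul (2 * lam))).sub
      ((hasDerivAt_id r).const_mul 12)
    refine h2.congr_deriv ?_
    unfold dipoleWeight
    field_simp
    ring
  have hcont : ContinuousOn (dipoleWeight lam) (Set.uIcc (0 : ℝ) (1 / 100)) := by
    unfold dipoleWeight
    exact ContinuousOn.inv₀ (by fun_prop) fun r hr => (pow_pos (hpos r hr) 2).ne'
  have hint : IntervalIntegrable (fun r => r * dipoleWeight lam r - 12) volume 0 (1 / 100) :=
    ((continuousOn_id.mul hcont).sub continuousOn_const).intervalIntegrable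
  have hint' : IntervalIntegrable
      (fun r => r * (dipoleWeight lam r * Real.exp (-(12 * r)))) volume 0 (1 / 100) :=
    (continuousOn_id.mul (hcont.mul (by fun_prop))).intervalIntegrable
  have hmono : ∫ r in (0 : ℝ)..(1 / 100), (r * dipoleWeight lam r - 12)
      ≤ ∫ r in (0 : ℝ)..(1 / 100), r * (dipoleWeight lam r * Real.exp (-(12 * r))) := by
    refine intervalIntegral.integral_mono_on (by norm_num) hint hint' fun r hr => ?_
    have h0 := hpos r (Set.Icc_subset_uIcc hr)
    have h1 : r * r * dipoleWeight lam r ≤ 1 := by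
      unfold dipoleWeight
      rw [← div_eq_mul_inv, div_le_one (by positivity)]
      nlinarith [hr.1]
    have h2 := Real.add_one_le_exp (-(12 * r))
    have h3 : 0 ≤ r * dipoleWeight lam r := mul_nonneg hr.1 (dipoleWeight_nonneg _ _)
    nlinarith [mul_le_mul_of_nonneg_left h2 h3]
  refine le_trans ?_ hmono
  rw [intervalIntegral.integral_eq_sub_of_hasDerivAt hderiv hint]
  have h1 : Real.log (1 / 100) ≤ Real.log (1 / 100 + 2 * lam) :=
    Real.log_le_log (by norm_num) (by linarith)
  have h2 : 0 ≤ 2 * lam * (1 / 100 + 2 * lam)⁻¹ := by positivity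
  have h3 : Real.log (0 + 2 * lam) = Real.log 2 + Real.log lam := by
    rw [zero_add, Real.log_mul two_ne_zero hl.ne']
  have h4 : 2 * lam * (0 + 2 * lam)⁻¹ = 1 := by
    rw [zero_add, mul_inv_cancel₀ (by positivity)]
  have h5 : Real.log 200 = Real.log 2 - Real.log (1 / 100) := by
    rw [← Real.log_div (by norm_num) (by norm_num)]; norm_num
  rw [h3, h4, h5]
  linarith

/-- Configurations in which each dipole `(P.1 i, P.2 i)` is short compared with its distance to
every other dipole. -/
def dipoleSet (N : ℕ) : Set (Conf N) :=
  {P | ∀ i j, i ≠ j → 2 * (dist (P.1 i) (P.2 i) + dist (P.1 j) (P.2 j))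
    < dist ((1 / 2 : ℝ) • (P.1 i + P.2 i)) ((1 / 2 : ℝ) • (P.1 j + P.2 j))}

theorem measurableSet_dipoleSet (N : ℕ) : MeasurableSet (dipoleSet N) := by
  simp only [dipoleSet, Set.ofPred_forall]
  exact MeasurableSet.iInter fun i => MeasurableSet.iInter fun j => MeasurableSet.iInter fun _ =>
    measurableSet_lt (by fun_prop) (by fun_prop)

theorem measurableSet_confSet (N : ℕ) : MeasurableSet (confSet N) := by
  simp only [confSet, Set.ofPred_and, Set.ofPred_forall]
  refine MeasurableSet.inter (MeasurableSet.iInter fun i => ?_) (MeasurableSet.iInter fun i => ?_)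
  · exact (show Measurable fun P : Conf N => P.1 i by fun_prop) (measurableSet_box 0 (√N))
  · exact (show Measurable fun P : Conf N => P.2 i by fun_prop) (measurableSet_box 0 (√N))

theorem volume_exclusion_closedBall_le {r s : ℝ} (hr : 0 ≤ r) (hs : 0 ≤ s) (hr' : r ≤ 1 / 100)
    (hs' : s ≤ 1 / 100) :
    volume (Metric.closedBall (0 : E2) (2 * (r + s))) ≤ ENNReal.ofReal (r + s) := by
  rw [Measure.addHaar_closedBall' _ _ (by positivity), volume_unit_closedBall,
    ← ENNReal.ofReal_mul (by positivity)]
  refine ENNReal.ofReal_le_ofReal ?_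
  simp only [finrank_euclideanSpace, Fintype.card_fin]
  have h1 : (2 * (r + s)) ^ 2 * π ≤ (2 * (r + s)) ^ 2 * 4 :=
    mul_le_mul_of_nonneg_left pi_le_four (sq_nonneg _)
  nlinarith

theorem le_volume_shrunken_box {N : ℕ} (hN : 1 ≤ N) {r : ℝ} (hr0 : 0 ≤ r) (hr : r ≤ 1 / 100) :
    ENNReal.ofReal (N * (1 - 4 * r)) ≤ volume {x : E2 | ∀ k, x k ∈ Set.Icc r (√N - r)} := by
  have hN1 : (1 : ℝ) ≤ N := by exact_mod_cast hN
  have hsq : (1 : ℝ) ≤ √N := Real.one_le_sqrt.2 hN1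
  have hsq2 : √(N : ℝ) * √N = N := Real.mul_self_sqrt (by positivity)
  rw [volume_box, ← ENNReal.ofReal_pow (by linarith)]
  refine ENNReal.ofReal_le_ofReal ?_
  have h2 : √(N : ℝ) ≤ N := by nlinarith
  nlinarith [mul_le_mul_of_nonneg_right h2 hr0]

/-- Volume available to the first charges when the dipole vectors `Z` are short. -/
theorem le_volume_slice {N : ℕ} (hN : 1 ≤ N) (Z : Fin N → E2) (hZ : ∀ i, ‖Z i‖ ≤ 1 / 100) :
    ENNReal.ofReal (N ^ N * ∏ i, Real.exp (-(12 * ‖Z i‖)))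
      ≤ volume {X : Fin N → E2 | (X, X + Z) ∈ confSet N ∩ dipoleSet N} := by
  have hN1 : (1 : ℝ) ≤ N := by exact_mod_cast hN
  obtain ⟨s, hs⟩ : ∃ s : ℝ, s = ∑ j, ‖Z j‖ := ⟨_, rfl⟩
  have hs0 : 0 ≤ s := hs ▸ Finset.sum_nonneg fun j _ => norm_nonneg _
  have hsN : s ≤ N * (1 / 100) := by
    rw [hs]
    refine (Finset.sum_le_sum fun j _ => hZ j).trans_eq ?_
    simp
  obtain ⟨q, hq⟩ : ∃ q : Fin N → ℝ, ∀ i, q i = N * (1 - 5 * ‖Z i‖) - s := ⟨_, fun _ => rfl⟩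
  have hq0 : ∀ i, 0 ≤ q i := by
    intro i
    have := hZ i
    rw [hq]
    nlinarith
  have hvol : ∀ i, ENNReal.ofReal (q i) +
      ∑ j, volume (Metric.closedBall (0 : E2) (2 * (‖Z i‖ + ‖Z j‖)))
      ≤ volume {x : E2 | ∀ k, x k ∈ Set.Icc ‖Z i‖ (√N - ‖Z i‖)} := by
    intro i
    have h1 : ∑ j, volume (Metric.closedBall (0 : E2) (2 * (‖Z i‖ + ‖Z j‖)))
        ≤ ENNReal.ofReal (N * ‖Z i‖ + s) := by
      refine (Finset.sum_le_sum fun j _ => volume_exclusion_closedBall_le (norm_nonneg (Z i))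
        (norm_nonneg (Z j)) (hZ i) (hZ j)).trans_eq ?_
      rw [← ENNReal.ofReal_sum_of_nonneg fun j _ =>
        add_nonneg (norm_nonneg (Z i)) (norm_nonneg (Z j))]
      congr 1
      rw [Finset.sum_add_distrib]
      simp [hs]
    refine (add_le_add le_rfl h1).trans ?_
    rw [← ENNReal.ofReal_add (hq0 i) (add_nonneg (by positivity) hs0), hq]
    refine le_trans (ENNReal.ofReal_le_ofReal (le_of_eq ?_))
      (le_volume_shrunken_box hN (norm_nonneg _) (hZ i))
    ring
  have hmain := prod_le_volume_separated (fun i => measurableSet_box _ _)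
    (fun i => (1 / 2 : ℝ) • Z i) (fun i j => 2 * (‖Z i‖ + ‖Z j‖)) hvol
  have hexp : (N : ℝ) ^ N * ∏ i, Real.exp (-(12 * ‖Z i‖)) ≤ ∏ i, q i := by
    have h1 : (N : ℝ) ^ N * ∏ i, Real.exp (-(12 * ‖Z i‖))
        = ∏ i, N * Real.exp (-(2 * (5 * ‖Z i‖ + s / N))) := by
      rw [Finset.prod_mul_distrib, Finset.prod_const, Finset.card_univ, Fintype.card_fin,
        ← Real.exp_sum, ← Real.exp_sum]
      congr 2
      simp only [Finset.sum_neg_distrib, ← Finset.mul_sum, Finset.sum_add_distrib,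
        Finset.sum_const, Finset.card_univ, Fintype.card_fin, nsmul_eq_mul]
      rw [← hs]
      field_simp
      ring
    rw [h1]
    refine Finset.prod_le_prod (fun i _ => by positivity) fun i _ => ?_
    have h2 : s / N ≤ 1 / 100 := by
      rw [div_le_iff₀ (by positivity)]; linarith
    have h3 := exp_neg_two_mul_le (t := 5 * ‖Z i‖ + s / N) (by positivity) (by linarith [hZ i])
    refine (mul_le_mul_of_nonneg_left h3 (by positivity)).trans_eq ?_
    rw [hq]
    field_simp
    ring
  calc ENNReal.ofReal (N ^ N * ∏ i, Real.exp (-(12 * ‖Z i‖)))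
      ≤ ENNReal.ofReal (∏ i, q i) := ENNReal.ofReal_le_ofReal hexp
    _ = ∏ i, ENNReal.ofReal (q i) := ENNReal.ofReal_prod_of_nonneg fun i _ => hq0 i
    _ ≤ _ := hmain
    _ ≤ _ := measure_mono ?_
  rintro X ⟨hX1, hX2⟩
  have hcoord : ∀ i k, |Z i k| ≤ ‖Z i‖ := fun i k => by
    simpa using PiLp.norm_apply_le (Z i) k
  have hmid : ∀ i, (1 / 2 : ℝ) • (X i + (X i + Z i)) = X i + (1 / 2 : ℝ) • Z i := by
    intro i; module
  have hd : ∀ i, dist (X i) (X i + Z i) = ‖Z i‖ := by intro i; simp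
  refine ⟨⟨fun i k => ?_, fun i k => ?_⟩, fun i j hij => ?_⟩
  · have := hX1 i k
    have hi0 := norm_nonneg (Z i)
    exact ⟨by linarith [this.1], by linarith [this.2]⟩
  · have := hX1 i k
    have h2 := abs_le.1 (hcoord i k)
    simp only [Pi.add_apply, PiLp.add_apply]
    exact ⟨by linarith [this.1], by linarith [this.2]⟩
  · simp only [Pi.add_apply, hmid, hd]
    rcases lt_or_gt_of_ne hij with h | h
    · exact hX2 i j h
    · rw [dist_comm, add_comm ‖Z i‖]
      exact hX2 j i h

theorem le_lintegral_dipoleSet {N : ℕ} (hN : 1 ≤ N) {lam : ℝ} (hl : 0 < lam) :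
    ENNReal.ofReal (N ^ N * (∫ z : E2, dampedWeight lam ‖z‖) ^ N)
      ≤ ∫⁻ P in confSet N ∩ dipoleSet N,
          ENNReal.ofReal (∏ i, dipoleWeight lam (dist (P.1 i) (P.2 i))) := by
  set A : Set (Conf N) := confSet N ∩ dipoleSet N with hA
  have hAm : MeasurableSet A := (measurableSet_confSet N).inter (measurableSet_dipoleSet N)
  set h : Conf N → ℝ≥0∞ := A.indicator fun P =>
    ENNReal.ofReal (∏ i, dipoleWeight lam (dist (P.1 i) (P.2 i))) with hh
  have hhm : Measurable h := by
    refine Measurable.indicator (Measurable.ennreal_ofReal ?_) hAm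
    refine Finset.measurable_prod _ fun i _ => (measurable_dipoleWeight lam).comp ?_
    fun_prop
  have hshear := measurePreserving_prod_add (volume : Measure (Fin N → E2))
    (volume : Measure (Fin N → E2))
  rw [← lintegral_indicator hAm, Measure.volume_eq_prod, ← hshear.lintegral_comp hhm,
    lintegral_prod_symm' (fun z : Conf N => h (z.1, z.1 + z.2)) (hhm.comp hshear.measurable)]
  have hpoint : ∀ Z : Fin N → E2, ENNReal.ofReal (N ^ N * ∏ i, dampedWeight lam ‖Z i‖)
      ≤ ∫⁻ X, h (X, X + Z) := by
    intro Z
    by_cases hZ : ∀ i, ‖Z i‖ ≤ 1 / 100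
    · have hfun : (fun X => h (X, X + Z)) = {X : Fin N → E2 | (X, X + Z) ∈ A}.indicator
          fun _ => ENNReal.ofReal (∏ i, dipoleWeight lam ‖Z i‖) := by
        funext X
        by_cases hX : (X, X + Z) ∈ A
        · rw [hh, Set.indicator_of_mem hX, Set.indicator_of_mem (by exact hX)]
          simp
        · rw [hh, Set.indicator_of_notMem hX, Set.indicator_of_notMem (by exact hX)]
      have hm : MeasurableSet {X : Fin N → E2 | (X, X + Z) ∈ A} :=
        (show Measurable fun X : Fin N → E2 => (X, X + Z) by fun_prop) hAm
      rw [hfun, lintegral_indicator hm, setLIntegral_const]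
      refine le_trans (le_of_eq ?_) (mul_le_mul_right (le_volume_slice hN Z hZ) _)
      rw [← ENNReal.ofReal_mul (Finset.prod_nonneg fun i _ => dipoleWeight_nonneg _ _)]
      congr 1
      simp only [dampedWeight_of_le (hZ _), Finset.prod_mul_distrib]
      ring
    · push Not at hZ
      obtain ⟨i, hi⟩ := hZ
      rw [Finset.prod_eq_zero (Finset.mem_univ i) (dampedWeight_of_lt hi)]
      simp
  refine le_trans (le_of_eq ?_) (lintegral_mono hpoint)
  have hint : Integrable fun Z : Fin N → E2 => (N : ℝ) ^ N * ∏ i, dampedWeight lam ‖Z i‖ :=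
    (Integrable.fintype_prod fun _ => integrable_dampedWeight hl).const_mul _
  rw [← ofReal_integral_eq_lintegral_ofReal hint
    (Filter.Eventually.of_forall fun Z => mul_nonneg (by positivity)
      (Finset.prod_nonneg fun i _ => dampedWeight_nonneg _ _)),
    integral_const_mul,
    integral_fintype_prod_volume_eq_pow (fun z : E2 => dampedWeight lam ‖z‖), Fintype.card_fin]

theorem measurePreserving_flipConf {N : ℕ} (S : Fin N → Bool) :
    MeasurePreserving (flipConf (N := N) S) volume volume := by
  have he := volume_measurePreserving_arrowProdEquivProdArrow E2 E2 (Fin N)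
  have hpi : MeasurePreserving
      (fun (Q : Fin N → E2 × E2) i => (bif S i then Prod.swap else id) (Q i)) volume volume := by
    refine volume_preserving_pi fun i => ?_
    cases S i
    · exact MeasurePreserving.id _
    · exact Measure.measurePreserving_swap
  have hfun : flipConf S = (MeasurableEquiv.arrowProdEquivProdArrow E2 E2 (Fin N) ∘
      fun (Q : Fin N → E2 × E2) i => (bif S i then Prod.swap else id) (Q i)) ∘
      (MeasurableEquiv.arrowProdEquivProdArrow E2 E2 (Fin N)).symm := by
    funext P
    refine Prod.ext (funext fun i => ?_) (funext fun i => ?_) <;>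
      cases h : S i <;>
      simp [flipConf, h, MeasurableEquiv.arrowProdEquivProdArrow, Equiv.arrowProdEquivProdArrow]
  rw [hfun]
  exact (he.comp hpi).comp he.symm

theorem flipConf_preimage {N : ℕ} (S : Fin N → Bool) :
    flipConf S ⁻¹' (confSet N ∩ dipoleSet N) = confSet N ∩ dipoleSet N := by
  ext P
  have h1 : ∀ i, dist ((flipConf S P).1 i) ((flipConf S P).2 i) = dist (P.1 i) (P.2 i) := by
    intro i
    cases h : S i <;> simp [flipConf, h, dist_comm]
  have h2 : ∀ i, (flipConf S P).1 i + (flipConf S P).2 i = P.1 i + P.2 i := by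
    intro i
    cases h : S i <;> simp [flipConf, h, add_comm]
  have h3 : ∀ i, ((flipConf S P).1 i ∈ LamBox N ∧ (flipConf S P).2 i ∈ LamBox N) ↔
      (P.1 i ∈ LamBox N ∧ P.2 i ∈ LamBox N) := by
    intro i
    cases h : S i <;> simp [flipConf, h, and_comm]
  refine and_congr ?_ ?_
  · change ((∀ i, _) ∧ ∀ i, _) ↔ ((∀ i, _) ∧ ∀ i, _)
    rw [← forall_and, ← forall_and]
    exact forall_congr' h3
  · simp only [dipoleSet, Set.mem_ofPred_eq, h1, h2]

theorem measurable_Flam (N : ℕ) {lam : ℝ} (hl : 0 < lam) :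
    Measurable fun P : Conf N => Flam N lam P.1 P.2 := by
  unfold Flam
  refine Measurable.sub_const (Measurable.const_mul ?_ _) _
  refine Finset.measurable_sum _ fun i _ => Finset.measurable_sum _ fun j _ => ?_
  refine (Measurable.add ?_ ?_).sub (Measurable.const_mul ?_ _) <;>
    exact (measurable_gsm hl).comp (by fun_prop)

/-- The Boltzmann weight at inverse temperature `2`. -/
def boltzmann (N : ℕ) (lam : ℝ) (P : Conf N) : ℝ≥0∞ :=
  ENNReal.ofReal (Real.exp (-2 * Flam N lam P.1 P.2))

theorem measurable_boltzmann (N : ℕ) {lam : ℝ} (hl : 0 < lam) : Measurable (boltzmann N lam) :=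
  (Real.measurable_exp.comp ((measurable_Flam N hl).const_mul _)).ennreal_ofReal

/-- Averaging over the orientations of the dipoles removes the interaction between them. -/
theorem lintegral_dipoleWeight_le {N : ℕ} {lam : ℝ} (hl : 0 < lam) :
    ∫⁻ P in confSet N ∩ dipoleSet N,
        ENNReal.ofReal (∏ i, dipoleWeight lam (dist (P.1 i) (P.2 i)))
      ≤ ∫⁻ P in confSet N ∩ dipoleSet N, boltzmann N lam P := by
  have hAm : MeasurableSet (confSet N ∩ dipoleSet N) :=
    (measurableSet_confSet N).inter (measurableSet_dipoleSet N)
  have hflip : ∀ S : Fin N → Bool,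
      ∫⁻ P in confSet N ∩ dipoleSet N, boltzmann N lam (flipConf S P)
        = ∫⁻ P in confSet N ∩ dipoleSet N, boltzmann N lam P := by
    intro S
    have h := (measurePreserving_flipConf S).setLIntegral_comp_preimage hAm
      (measurable_boltzmann N hl)
    rwa [flipConf_preimage] at h
  have h2 : (2 : ℝ≥0∞) ^ N ≠ 0 := by positivity
  have h2' : (2 : ℝ≥0∞) ^ N ≠ ⊤ := ENNReal.pow_ne_top ENNReal.ofNat_ne_top
  rw [← ENNReal.mul_le_mul_iff_right h2 h2', ← lintegral_const_mul' _ _ h2']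
  calc _ ≤ ∫⁻ P in confSet N ∩ dipoleSet N,
          ∑ S : Fin N → Bool, boltzmann N lam (flipConf S P) := by
        refine lintegral_mono fun P => ?_
        have h := ENNReal.ofReal_le_ofReal (two_pow_mul_prod_le_sum_exp hl P)
        rw [ENNReal.ofReal_mul (by positivity),
          ENNReal.ofReal_sum_of_nonneg fun S _ => (Real.exp_pos _).le,
          ENNReal.ofReal_pow zero_le_two, ENNReal.ofReal_ofNat] at h
        exact h
    _ = ∑ S : Fin N → Bool, ∫⁻ P in confSet N ∩ dipoleSet N, boltzmann N lam (flipConf S P) :=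
        lintegral_finsetSum _ fun S _ =>
          (measurable_boltzmann N hl).comp (measurePreserving_flipConf S).measurable
    _ = _ := by
        simp only [hflip]
        rw [Finset.sum_const, card_signs, nsmul_eq_mul]
        push_cast
        rfl

/-- Relabel the negative charges. -/
def permConf {N : ℕ} (σ : Equiv.Perm (Fin N)) (P : Conf N) : Conf N := (P.1, fun i => P.2 (σ i))

theorem measurePreserving_permConf {N : ℕ} (σ : Equiv.Perm (Fin N)) :
    MeasurePreserving (permConf (N := N) σ) volume volume := by
  have h := volume_measurePreserving_piCongrLeft (fun _ : Fin N => E2) σ.symm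
  have h' := (MeasurePreserving.id (volume : Measure (Fin N → E2))).prod h
  have hfun : permConf σ
      = Prod.map id (MeasurableEquiv.piCongrLeft (fun _ : Fin N => E2) σ.symm) := by
    funext P
    refine Prod.ext rfl (funext fun i => ?_)
    obtain ⟨k, rfl⟩ := σ.symm.surjective i
    exact (by simp [permConf] : (permConf σ P).2 (σ.symm k) = P.2 k).trans
      (MeasurableEquiv.piCongrLeft_apply_apply (β := fun _ : Fin N => E2) σ.symm P.2 k).symm
  rw [hfun]
  exact h'

theorem boltzmann_permConf {N : ℕ} (lam : ℝ) (σ : Equiv.Perm (Fin N)) (P : Conf N) :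
    boltzmann N lam (permConf σ P) = boltzmann N lam P := by
  have h1 : ∑ i, ∑ j, gsm lam (P.2 (σ i) - P.2 (σ j)) = ∑ i, ∑ j, gsm lam (P.2 i - P.2 j) := by
    rw [← Equiv.sum_comp σ fun i => ∑ j, gsm lam (P.2 i - P.2 j)]
    exact Finset.sum_congr rfl fun i _ => Equiv.sum_comp σ fun j => gsm lam (P.2 (σ i) - P.2 j)
  have h2 : ∀ i, ∑ j, gsm lam (P.1 i - P.2 (σ j)) = ∑ j, gsm lam (P.1 i - P.2 j) := fun i =>
    Equiv.sum_comp σ fun j => gsm lam (P.1 i - P.2 j)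
  simp only [boltzmann, Flam, permConf, Finset.sum_sub_distrib, Finset.sum_add_distrib,
    ← Finset.mul_sum, h1, h2]

/-- In a configuration of `dipoleSet` the partner of `P.1 i` is its nearest negative charge. -/
theorem dist_lt_of_mem_dipoleSet {N : ℕ} {P : Conf N} (hP : P ∈ dipoleSet N) {i j : Fin N}
    (h : i ≠ j) : dist (P.1 i) (P.2 i) < dist (P.1 i) (P.2 j) := by
  have h1 := hP i j h
  have hi : dist ((1 / 2 : ℝ) • (P.1 i + P.2 i)) (P.1 i) = dist (P.1 i) (P.2 i) / 2 := by
    have : (1 / 2 : ℝ) • (P.1 i + P.2 i) - P.1 i = (-(1 / 2) : ℝ) • (P.1 i - P.2 i) := by module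
    rw [dist_eq_norm, this, norm_smul, dist_eq_norm]
    norm_num
    ring
  have hj : dist (P.2 j) ((1 / 2 : ℝ) • (P.1 j + P.2 j)) = dist (P.1 j) (P.2 j) / 2 := by
    have : P.2 j - (1 / 2 : ℝ) • (P.1 j + P.2 j) = (-(1 / 2) : ℝ) • (P.1 j - P.2 j) := by module
    rw [dist_eq_norm, this, norm_smul, dist_eq_norm]
    norm_num
    ring
  have h2 := dist_triangle4 ((1 / 2 : ℝ) • (P.1 i + P.2 i)) (P.1 i) (P.2 j)
    ((1 / 2 : ℝ) • (P.1 j + P.2 j))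
  have h3 := dist_nonneg (x := P.1 i) (y := P.2 i)
  have h4 := dist_nonneg (x := P.1 j) (y := P.2 j)
  linarith

theorem eq_of_permConf_mem_dipoleSet {N : ℕ} {P : Conf N} {σ τ : Equiv.Perm (Fin N)}
    (hσ : permConf σ P ∈ dipoleSet N) (hτ : permConf τ P ∈ dipoleSet N) : σ = τ := by
  ext i
  by_contra hne
  have hne' : σ i ≠ τ i := fun h => hne (congrArg _ h)
  have h1 := dist_lt_of_mem_dipoleSet hσ (i := i) (j := σ.symm (τ i))
    fun h => hne' ((Equiv.eq_symm_apply σ).1 h)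
  have h2 := dist_lt_of_mem_dipoleSet hτ (i := i) (j := τ.symm (σ i))
    fun h => hne' ((Equiv.eq_symm_apply τ).1 h).symm
  simp only [permConf, Equiv.apply_symm_apply] at h1 h2
  exact lt_asymm h1 h2

theorem permConf_mem_confSet {N : ℕ} {P : Conf N} {σ : Equiv.Perm (Fin N)}
    (h : permConf σ P ∈ confSet N) : P ∈ confSet N :=
  ⟨h.1, fun i => by simpa [permConf] using h.2 (σ.symm i)⟩

theorem factorial_mul_lintegral_le {N : ℕ} {lam : ℝ} (hl : 0 < lam) :
    (N.factorial : ℝ≥0∞) * ∫⁻ P in confSet N ∩ dipoleSet N, boltzmann N lam P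
      ≤ ∫⁻ P in confSet N, boltzmann N lam P := by
  set A : Set (Conf N) := confSet N ∩ dipoleSet N with hA
  have hAm : MeasurableSet A := (measurableSet_confSet N).inter (measurableSet_dipoleSet N)
  have hm : Measurable (A.indicator (boltzmann N lam)) := (measurable_boltzmann N hl).indicator hAm
  have hpoint : ∀ P : Conf N,
      ∑ σ : Equiv.Perm (Fin N), A.indicator (boltzmann N lam) (permConf σ P)
      ≤ (confSet N).indicator (boltzmann N lam) P := by
    intro P
    by_cases h : ∃ σ : Equiv.Perm (Fin N), permConf σ P ∈ A
    · obtain ⟨σ, hσ⟩ := h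
      rw [Finset.sum_eq_single σ ?_ (by simp), Set.indicator_of_mem hσ,
        Set.indicator_of_mem (permConf_mem_confSet hσ.1), boltzmann_permConf]
      intro τ _ hτ
      exact Set.indicator_of_notMem (fun h => hτ (eq_of_permConf_mem_dipoleSet h.2 hσ.2)) _
    · push Not at h
      rw [Finset.sum_eq_zero fun σ _ => Set.indicator_of_notMem (h σ) _]
      exact zero_le
  rw [← lintegral_indicator hAm, ← lintegral_indicator (measurableSet_confSet N)]
  refine le_trans (le_of_eq ?_) (lintegral_mono hpoint)
  rw [lintegral_finsetSum (f := fun σ (P : Conf N) => A.indicator (boltzmann N lam) (permConf σ P))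
    Finset.univ fun σ _ => hm.comp (measurePreserving_permConf σ).measurable]
  simp only [(measurePreserving_permConf _).lintegral_comp hm]
  rw [Finset.sum_const, Finset.card_univ, Fintype.card_perm, Fintype.card_fin, nsmul_eq_mul]

theorem volume_confSet_lt_top (N : ℕ) : volume (confSet N) < ⊤ := by
  have : confSet N = (Set.univ.pi fun _ => LamBox N) ×ˢ (Set.univ.pi fun _ => LamBox N) := by
    ext P; simp [confSet]
  have hbox : volume (LamBox N) < ⊤ := by
    rw [LamBox, volume_box]
    exact ENNReal.pow_lt_top ENNReal.ofReal_lt_top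
  rw [this, Measure.volume_eq_prod, Measure.prod_prod, volume_pi_pi]
  exact ENNReal.mul_lt_top (ENNReal.prod_lt_top fun _ _ => hbox)
    (ENNReal.prod_lt_top fun _ _ => hbox)

theorem norm_le_of_mem_LamBox {N : ℕ} {x : E2} (hx : x ∈ LamBox N) : ‖x‖ ≤ 2 * √N := by
  refine (pow_le_pow_iff_left₀ (norm_nonneg x) (by positivity) two_ne_zero).1 ?_
  rw [EuclideanSpace.real_norm_sq_eq, Fin.sum_univ_two]
  have h0 := hx 0
  have h1 := hx 1
  nlinarith [pow_le_pow_left₀ h0.1 h0.2 2, pow_le_pow_left₀ h1.1 h1.2 2, sq_nonneg √(N : ℝ)]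

theorem exists_abs_gsm_sub_le (N : ℕ) {lam : ℝ} (hl : 0 < lam) :
    ∃ K : ℝ, ∀ x ∈ LamBox N, ∀ y ∈ LamBox N, |gsm lam (x - y)| ≤ K := by
  obtain ⟨K, hK⟩ := exists_gsm_le hl
  refine ⟨max K (Real.log (4 * √N + 2 * lam)), fun x hx y hy => abs_le'.2 ⟨?_, ?_⟩⟩
  · exact (hK _).trans (le_max_left _ _)
  · refine le_trans ?_ (le_max_right _ _)
    have h1 : ‖x - y‖ ≤ 4 * √N := by
      have := norm_sub_le x y
      linarith [norm_le_of_mem_LamBox hx, norm_le_of_mem_LamBox hy]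
    have h2 := le_gsm hl (x - y)
    have h3 := Real.log_le_log (by positivity)
      (show ‖x - y‖ + 2 * lam ≤ 4 * √N + 2 * lam by linarith)
    linarith

theorem lintegral_boltzmann_ne_top (N : ℕ) {lam : ℝ} (hl : 0 < lam) :
    ∫⁻ P in confSet N, boltzmann N lam P ≠ ⊤ := by
  obtain ⟨K, hK⟩ := exists_abs_gsm_sub_le N hl
  have hF : ∀ P ∈ confSet N, -2 * Flam N lam P.1 P.2
      ≤ N * (N * (4 * K)) + 2 * N * (-Real.log lam + kappa) := by
    intro P hP
    have h1 : ∑ i : Fin N, ∑ j : Fin N, -(gsm lam (P.1 i - P.1 j) + gsm lam (P.2 i - P.2 j)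
        - 2 * gsm lam (P.1 i - P.2 j)) ≤ ∑ _i : Fin N, ∑ _j : Fin N, 4 * K := by
      refine Finset.sum_le_sum fun i _ => Finset.sum_le_sum fun j _ => ?_
      have a := abs_le.1 (hK _ (hP.1 i) _ (hP.1 j))
      have b := abs_le.1 (hK _ (hP.2 i) _ (hP.2 j))
      have c := abs_le.1 (hK _ (hP.1 i) _ (hP.2 j))
      linarith [a.1, b.1, c.2]
    simp only [Finset.sum_neg_distrib, Finset.sum_const, Finset.card_univ, Fintype.card_fin,
      nsmul_eq_mul] at h1
    rw [Flam]
    linarith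
  refine ne_top_of_le_ne_top ?_ (setLIntegral_mono measurable_const
    fun P hP => ENNReal.ofReal_le_ofReal (Real.exp_le_exp.2 (hF P hP)))
  rw [setLIntegral_const]
  exact (ENNReal.mul_lt_top ENNReal.ofReal_lt_top (volume_confSet_lt_top N)).ne

theorem le_Zpart {N : ℕ} (hN : 1 ≤ N) {lam : ℝ} (hl : 0 < lam) :
    N.factorial * (N ^ N * (∫ z : E2, dampedWeight lam ‖z‖) ^ N) ≤ Zpart N 2 lam := by
  have hZ : Zpart N 2 lam = (∫⁻ P in confSet N, boltzmann N lam P).toReal := by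
    rw [Zpart, integral_eq_lintegral_of_nonneg_ae
      (Filter.Eventually.of_forall fun P => (Real.exp_pos _).le)
      (Real.measurable_exp.comp ((measurable_Flam N hl).const_mul _)).aestronglyMeasurable]
    rfl
  rw [hZ]
  refine (ENNReal.ofReal_le_iff_le_toReal (lintegral_boltzmann_ne_top N hl)).1 ?_
  refine le_trans ?_ (factorial_mul_lintegral_le hl)
  rw [ENNReal.ofReal_mul (by positivity), ENNReal.ofReal_natCast]
  gcongr
  exact (le_lintegral_dipoleSet hN hl).trans (lintegral_dipoleWeight_le hl)

theorem le_log_factorial (N : ℕ) (hN : 1 ≤ N) : N * Real.log N - N ≤ Real.log N.factorial := by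
  have hN0 : (0 : ℝ) < N := by exact_mod_cast hN
  have hf : (0 : ℝ) < N.factorial := by exact_mod_cast N.factorial_pos
  have h := Real.log_le_log (by positivity) (Real.pow_div_factorial_le_exp (N : ℝ) hN0.le N)
  rw [Real.log_exp, Real.log_div (by positivity) hf.ne', Real.log_pow] at h
  linarith

theorem log_sub_two_mul_div_le {L C : ℝ} (hC : 0 < C) (hL : 2 * C ≤ L) :
    Real.log L - 2 * C / L ≤ Real.log (L - C) := by
  have hL0 : 0 < L := by linarith
  have h1 : C / L ≤ 1 / 2 := by rw [div_le_iff₀ hL0]; linarith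
  have h2 := exp_neg_two_mul_le (by positivity) h1
  have h3 := Real.log_le_log (by positivity) (mul_le_mul_of_nonneg_left h2 hL0.le)
  rw [Real.log_mul hL0.ne' (Real.exp_pos _).ne', Real.log_exp, mul_sub, mul_one,
    mul_div_cancel₀ _ hL0.ne'] at h3
  rw [mul_div_assoc]
  linarith

/-- Free energy lower bound for `β = 2` (Proposition 4.1, second part). -/
theorem statement6 :
    ∃ C lam0 : ℝ, 0 < C ∧ 0 < lam0 ∧ lam0 < 1/2 ∧
      ∀ lam : ℝ, 0 < lam → lam < lam0 → ∀ N : ℕ, 1 ≤ N →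
        2 * N * Real.log N + N * Real.log |Real.log lam| +
            N * (Real.log (2 * Real.pi) - 1) - C * N / |Real.log lam| ≤
          Real.log (Zpart N 2 lam) := by
  obtain ⟨c, hc⟩ : ∃ c : ℝ, c = Real.log 200 + 2 := ⟨_, rfl⟩
  have hc0 : 0 < c := by
    have : 0 ≤ Real.log 200 := Real.log_nonneg (by norm_num)
    linarith
  refine ⟨2 * c, min (1 / 4) (Real.exp (-(2 * c))), by positivity, by positivity,
    (min_le_left _ _).trans_lt (by norm_num), fun lam hl hlt N hN => ?_⟩
  obtain ⟨L, hL⟩ : ∃ L : ℝ, L = -Real.log lam := ⟨_, rfl⟩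
  have hL1 : 2 * c < L := by
    have := (Real.log_lt_iff_lt_exp hl).2 (hlt.trans_le (min_le_right _ _))
    linarith
  have habs : |Real.log lam| = L := by
    rw [abs_of_neg (by linarith), hL]
  have hJ := le_integral_dampedWeight hl
  rw [← hc, ← hL] at hJ
  set J := ∫ z : E2, dampedWeight lam ‖z‖
  have hLc : 0 < L - c := by linarith
  have hJ1 : 0 < 2 * π * (L - c) := by positivity
  have hJ0 : 0 < J := hJ1.trans_le hJ
  have hlogJ : Real.log (2 * π) + (Real.log L - 2 * c / L) ≤ Real.log J := by
    refine le_trans ?_ (Real.log_le_log hJ1 hJ)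
    rw [Real.log_mul (by positivity) hLc.ne']
    linarith [log_sub_two_mul_div_le hc0 hL1.le]
  have hN0 : (0 : ℝ) < N := by exact_mod_cast hN
  have hf : (0 : ℝ) < N.factorial := by exact_mod_cast N.factorial_pos
  have hZ := Real.log_le_log (by positivity) (le_Zpart hN hl)
  rw [Real.log_mul hf.ne' (by positivity), Real.log_mul (by positivity) (by positivity),
    Real.log_pow, Real.log_pow] at hZ
  refine le_trans ?_ hZ
  have h1 := le_log_factorial N hN
  have h2 := mul_le_mul_of_nonneg_left hlogJ hN0.le
  rw [habs, show 2 * c * N / L = N * (2 * c / L) by ring]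
  linarith
end
end

section
/- There exists a universal constant C > 0 such that: (i) for all λ > 0 and all z ∈ ℝ², |g_λ(z) − g( max(|z|, λ) )| ≤ C, where g(r) = −log r; and (ii) for all z ∈ ℝ² with |z| ≤ 1, |g_1(z) − κ| ≤ C |z|². -/
open MeasureTheory Real
open scoped ENNReal NNReal BigOperators Classical

noncomputable section

section

open Metric Set

/-- Integration over a disc of `ℂ` centred at the origin in polar coordinates. -/
lemma setIntegral_closedBall_zero_eq_circleAverage {f : ℂ → ℝ} (hf : Measurable f) {R : ℝ}
    (hR : 0 ≤ R) (hint : IntegrableOn f (closedBall 0 R)) :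
    ∫ w in closedBall (0 : ℂ) R, f w = ∫ r in (0 : ℝ)..R, 2 * π * (r * circleAverage f 0 r) := by
  set F : ℂ → ℝ := (closedBall (0 : ℂ) R).indicator f with hF
  have hFm : Measurable F := hf.indicator isClosed_closedBall.measurableSet
  have hFi : Integrable F := (integrable_indicator_iff isClosed_closedBall.measurableSet).2 hint
  have hsymm : Measurable (fun p : ℝ × ℝ => Complex.polarCoord.symm p) := by
    simp only [Complex.polarCoord_symm_apply]
    fun_prop
  have hG : IntegrableOn (fun p : ℝ × ℝ => p.1 • F (Complex.polarCoord.symm p))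
      (Ioi (0 : ℝ) ×ˢ Ioo (-π) π) (volume.prod volume) := by
    refine ⟨(measurable_fst.smul (hFm.comp hsymm)).aestronglyMeasurable, ?_⟩
    have h := Complex.lintegral_comp_polarCoord_symm (fun w => ‖F w‖ₑ)
    have h2 : ∫⁻ w, ‖F w‖ₑ < ⊤ := hFi.2
    rw [← h, polarCoord_target] at h2
    refine lt_of_eq_of_lt ?_ h2
    refine setLIntegral_congr_fun (measurableSet_Ioi.prod measurableSet_Ioo) ?_
    rintro ⟨r, θ⟩ ⟨hr, -⟩
    simp only [mem_Ioi] at hr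
    simp [enorm_mul, Real.enorm_eq_ofReal hr.le]
  rw [← integral_indicator isClosed_closedBall.measurableSet, ← hF,
    ← Complex.integral_comp_polarCoord_symm, polarCoord_target, Measure.volume_eq_prod,
    setIntegral_prod _ hG, intervalIntegral.integral_of_le hR, ← Ioi_inter_Iic,
    ← setIntegral_indicator measurableSet_Iic]
  refine setIntegral_congr_fun measurableSet_Ioi fun r hr => ?_
  simp only [mem_Ioi] at hr
  have hnorm (θ : ℝ) : ‖Complex.polarCoord.symm (r, θ)‖ = r := by
    rw [Complex.norm_polarCoord_symm, abs_of_pos hr]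
  by_cases hrR : r ≤ R
  · have hval (θ : ℝ) : r • F (Complex.polarCoord.symm (r, θ)) = r * f (circleMap 0 r θ) := by
      rw [hF, indicator_of_mem (by simpa [abs_of_pos hr] using hrR)]
      simp [circleMap, Complex.exp_mul_I]
    have hper := ((periodic_circleMap (0 : ℂ) r).comp f).intervalIntegral_add_eq (-π) 0
    rw [show -π + 2 * π = π by ring, zero_add] at hper
    simp only [hval, Function.comp_apply] at hper ⊢
    rw [integral_const_mul, ← integral_Ioc_eq_integral_Ioo,
      ← intervalIntegral.integral_of_le (by linarith [pi_pos]), hper,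
      indicator_of_mem (by simpa using hrR), circleAverage_def, smul_eq_mul]
    field_simp
  · have hval (θ : ℝ) : r • F (Complex.polarCoord.symm (r, θ)) = 0 := by
      rw [hF, indicator_of_notMem (by simpa [abs_of_pos hr] using hrR), smul_zero]
    simp only [hval]
    rw [indicator_of_notMem (by simpa using hrR)]
    simp

lemma Complex.integrableOn_log_norm_sub (a : ℂ) (R : ℝ) :
    IntegrableOn (fun w => Real.log ‖w - a‖) (closedBall 0 R) := by
  have h0 : IntegrableOn (fun w : ℂ => Real.log ‖w‖) (ball 0 (R + ‖a‖ + 1)) := by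
    rw [integrableOn_fun_norm_addHaar volume (f := Real.log)]
    simp only [Complex.finrank_real_complex, Nat.add_one_sub_one, pow_one, smul_eq_mul]
    exact (Real.continuous_mul_log.continuousOn.integrableOn_compact
      isCompact_Icc).mono_set Ioo_subset_Icc_self
  have h1 := ((measurePreserving_sub_right volume a).integrableOn_comp_preimage
    (MeasurableEquiv.subRight a).measurableEmbedding).2 h0
  refine h1.mono_set fun w hw => ?_
  simp only [mem_closedBall, dist_zero_right, mem_preimage, mem_ball] at hw ⊢
  linarith [norm_sub_le w a]

/-- Minus the potential, at distance `a` from the centre, of a unit charge spread uniformly over a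
disc of radius `R`. -/
def discLogPotential (R a : ℝ) : ℝ :=
  if a ≤ R then Real.log R - (1 - a ^ 2 / R ^ 2) / 2 else Real.log a

lemma integral_mul_log {a b : ℝ} (ha : 0 ≤ a) (hab : a ≤ b) :
    ∫ r in a..b, r * Real.log r =
      (b ^ 2 * Real.log b / 2 - b ^ 2 / 4) - (a ^ 2 * Real.log a / 2 - a ^ 2 / 4) := by
  have hcont : Continuous fun r : ℝ => r ^ 2 * Real.log r / 2 - r ^ 2 / 4 := by
    have h := Real.continuous_mul_log
    have : (fun r : ℝ => r ^ 2 * Real.log r / 2 - r ^ 2 / 4) =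
        fun r : ℝ => r * (r * Real.log r) / 2 - r ^ 2 / 4 := by
      ext r
      ring
    rw [this]
    fun_prop
  refine intervalIntegral.integral_eq_sub_of_hasDerivAt_of_le hab hcont.continuousOn
    (fun r hr => ?_) (Real.continuous_mul_log.intervalIntegrable _ _)
  have hr0 : r ≠ 0 := (ha.trans_lt hr.1).ne'
  convert! ((((hasDerivAt_pow 2 r).mul (Real.hasDerivAt_log hr0)).div_const 2).sub
    ((hasDerivAt_pow 2 r).div_const 4)) using 1
  field_simp
  ring

lemma log_add_posLog_inv_mul_of_le {a r : ℝ} (hr : 0 < r) (hra : r ≤ a) :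
    Real.log r + Real.posLog (r⁻¹ * a) = Real.log a := by
  have ha : 0 < a := hr.trans_le hra
  have h1 : 1 ≤ r⁻¹ * a := by rwa [inv_mul_eq_div, one_le_div hr]
  rw [Real.posLog_eq_log (h1.trans (le_abs_self _)), Real.log_mul (inv_ne_zero hr.ne') ha.ne',
    Real.log_inv]
  ring

lemma log_add_posLog_inv_mul_of_ge {a r : ℝ} (hr : 0 < r) (ha : 0 ≤ a) (har : a ≤ r) :
    Real.log r + Real.posLog (r⁻¹ * a) = Real.log r := by
  have h1 : |r⁻¹ * a| ≤ 1 := by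
    rwa [abs_of_nonneg (by positivity), inv_mul_eq_div, div_le_one hr]
  rw [(Real.posLog_eq_zero_iff _).2 h1, add_zero]

lemma integral_mul_log_add_posLog {a R : ℝ} (ha : 0 ≤ a) (hR : 0 < R) :
    ∫ r in (0 : ℝ)..R, 2 * π * (r * (Real.log r + Real.posLog (r⁻¹ * a))) =
      π * R ^ 2 * discLogPotential R a := by
  set φ : ℝ → ℝ := fun r => r * (Real.log r + Real.posLog (r⁻¹ * a)) with hφ
  have hle {b : ℝ} (hba : b ≤ a) : EqOn φ (fun r => r * Real.log a) (Ioo 0 b) := fun r hr => by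
    simp only [hφ, log_add_posLog_inv_mul_of_le hr.1 (hr.2.le.trans hba)]
  have hge : EqOn φ (fun r => r * Real.log r) (Ioo a R) := fun r hr => by
    simp only [hφ, log_add_posLog_inv_mul_of_ge (ha.trans_lt hr.1) ha hr.1.le]
  have hint {b : ℝ} (hb : 0 ≤ b) (hba : b ≤ a) :
      ∫ r in (0 : ℝ)..b, φ r = b ^ 2 / 2 * Real.log a := by
    rw [intervalIntegral.integral_congr_Ioo_of_le hb (hle hba),
      intervalIntegral.integral_mul_const, integral_id]
    ring
  rw [intervalIntegral.integral_const_mul, discLogPotential]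
  split_ifs with haR
  · have hi₁ : IntervalIntegrable φ volume 0 a :=
      ((continuous_mul_const (Real.log a)).intervalIntegrable 0 a).congr_uIoo
        (uIoo_of_le ha ▸ (hle le_rfl).symm)
    have hi₂ : IntervalIntegrable φ volume a R :=
      (Real.continuous_mul_log.intervalIntegrable a R).congr_uIoo (uIoo_of_le haR ▸ hge.symm)
    rw [← intervalIntegral.integral_add_adjacent_intervals hi₁ hi₂, hint ha le_rfl,
      intervalIntegral.integral_congr_Ioo_of_le haR hge, integral_mul_log ha haR]
    field_simp
    ring
  · rw [hint hR.le (not_le.1 haR).le]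
    ring

lemma setIntegral_log_norm_sub (a : ℂ) {R : ℝ} (hR : 0 < R) :
    ∫ w in closedBall (0 : ℂ) R, Real.log ‖w - a‖ = π * R ^ 2 * discLogPotential R ‖a‖ := by
  rw [setIntegral_closedBall_zero_eq_circleAverage (by fun_prop) hR.le
    (Complex.integrableOn_log_norm_sub a R), ← integral_mul_log_add_posLog (norm_nonneg a) hR,
    intervalIntegral.integral_of_le hR.le, intervalIntegral.integral_of_le hR.le]
  refine setIntegral_congr_fun measurableSet_Ioc fun r hr => ?_
  rw [circleAverage_log_norm_sub_const_eq_log_radius_add_posLog hr.1.ne', zero_sub, norm_neg]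

lemma E2.setIntegral_log_norm_sub (a : E2) {R : ℝ} (hR : 0 < R) :
    ∫ w in closedBall (0 : E2) R, Real.log ‖w - a‖ = π * R ^ 2 * discLogPotential R ‖a‖ := by
  let e : ℂ ≃ₗᵢ[ℝ] E2 := Complex.orthonormalBasisOneI.repr
  have h := e.measurePreserving.setIntegral_preimage_emb
    e.toHomeomorph.measurableEmbedding (fun w => Real.log ‖w - a‖) (closedBall 0 R)
  have hpre : e ⁻¹' closedBall 0 R = closedBall 0 R := by
    ext w
    simp
  rw [← h, hpre, ← e.symm.norm_map a, ← _root_.setIntegral_log_norm_sub _ hR]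
  refine setIntegral_congr_fun isClosed_closedBall.measurableSet fun w _ => ?_
  rw [← e.norm_map (w - e.symm a), map_sub, e.apply_symm_apply]

lemma volume_closedBall_E2 (z : E2) {R : ℝ} (hR : 0 < R) :
    volume (closedBall z R) = ENNReal.ofReal (π * R ^ 2) := by
  rw [EuclideanSpace.volume_closedBall_fin_two, ← ENNReal.ofReal_pow hR.le,
    ← ENNReal.ofReal_mul (by positivity), mul_comm]

lemma isProbabilityMeasure_udisc (z : E2) {R : ℝ} (hR : 0 < R) :
    IsProbabilityMeasure (udisc z R) := by
  constructor
  rw [udisc, Measure.smul_apply, Measure.restrict_apply_univ, smul_eq_mul]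
  exact ENNReal.inv_mul_cancel (measure_closedBall_pos volume z hR).ne'
    measure_closedBall_lt_top.ne

lemma integral_udisc_s16 (f : E2 → ℝ) (z : E2) {R : ℝ} (hR : 0 < R) :
    ∫ x, f x ∂udisc z R = (π * R ^ 2)⁻¹ * ∫ x in closedBall z R, f x := by
  rw [udisc, integral_smul_measure, volume_closedBall_E2 z hR, ENNReal.toReal_inv,
    ENNReal.toReal_ofReal (by positivity), smul_eq_mul]

lemma integral_gfun_udisc (x z : E2) {R : ℝ} (hR : 0 < R) :
    ∫ y, gfun (x - y) ∂udisc z R = -discLogPotential R ‖x - z‖ := by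
  have h := (measurePreserving_add_right volume z).setIntegral_preimage_emb
    (MeasurableEquiv.addRight z).measurableEmbedding (fun y => gfun (x - y)) (closedBall z R)
  have hpre : (fun y => y + z) ⁻¹' closedBall z R = closedBall 0 R := by
    ext w
    simp
  have hfun (w : E2) : gfun (x - (w + z)) = -Real.log ‖w - (x - z)‖ := by
    rw [gfun, ← norm_neg]
    congr 3
    abel
  rw [integral_udisc_s16 _ _ hR, ← h, hpre]
  simp only [hfun]
  rw [integral_neg, E2.setIntegral_log_norm_sub _ hR]
  field_simp

lemma gsm_eq_integral (z : E2) {R : ℝ} (hR : 0 < R) :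
    gsm R z = ∫ x, -discLogPotential R ‖x - z‖ ∂udisc 0 R := by
  simp only [gsm, integral_gfun_udisc _ _ hR]

lemma ae_udisc_mem_closedBall (z : E2) (R : ℝ) :
    ∀ᵐ x ∂udisc z R, x ∈ closedBall z R :=
  Measure.ae_smul_measure (ae_restrict_mem isClosed_closedBall.measurableSet) _

lemma abs_integral_udisc_le {f : E2 → ℝ} {R C : ℝ} (hR : 0 < R)
    (hf : ∀ x, ‖x‖ ≤ R → |f x| ≤ C) : |∫ x, f x ∂udisc 0 R| ≤ C := by
  have := isProbabilityMeasure_udisc 0 hR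
  have h := norm_integral_le_of_norm_le_const (μ := udisc 0 R) (f := f) (C := C) <| by
    filter_upwards [ae_udisc_mem_closedBall 0 R] with x hx
    exact hf x (by simpa using hx)
  simpa using h

lemma measurable_discLogPotential (R : ℝ) : Measurable (discLogPotential R) := by
  unfold discLogPotential
  exact Measurable.ite measurableSet_Iic (by fun_prop) (by fun_prop)

lemma abs_discLogPotential_sub_log_max_le {a R : ℝ} (ha : 0 ≤ a) (hR : 0 < R) :
    |discLogPotential R a - Real.log (max a R)| ≤ 1 / 2 := by
  unfold discLogPotential
  split_ifs with h
  · have h1 : a ^ 2 / R ^ 2 ≤ 1 := by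
      rw [div_le_one (by positivity)]
      gcongr
    have h2 : 0 ≤ a ^ 2 / R ^ 2 := by positivity
    rw [max_eq_right h, abs_le]
    constructor <;> linarith
  · rw [max_eq_left (not_le.1 h).le]
    norm_num

lemma abs_log_sub_log_le {s t c : ℝ} (hs : 0 < s) (ht : 0 < t) (hc : 0 < c) (hst : s ≤ c * t)
    (hts : t ≤ c * s) : |Real.log s - Real.log t| ≤ Real.log c := by
  have h1 := Real.log_le_log hs hst
  have h2 := Real.log_le_log ht hts
  rw [Real.log_mul hc.ne' ht.ne'] at h1
  rw [Real.log_mul hc.ne' hs.ne'] at h2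
  rw [abs_le]
  constructor <;> linarith

lemma abs_log_max_norm_sub_le {x z : E2} {R : ℝ} (hR : 0 < R) (hx : ‖x‖ ≤ R) :
    |Real.log (max ‖x - z‖ R) - Real.log (max ‖z‖ R)| ≤ Real.log 2 := by
  have h1 : ‖x - z‖ ≤ ‖x‖ + ‖z‖ := norm_sub_le x z
  have h2 : ‖z‖ ≤ ‖x‖ + ‖x - z‖ := by
    simpa using norm_sub_le x (x - z)
  have h3 := le_max_left ‖x - z‖ R
  have h4 := le_max_right ‖x - z‖ R
  have h5 := le_max_left ‖z‖ R
  have h6 := le_max_right ‖z‖ R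
  refine abs_log_sub_log_le (hR.trans_le h4) (hR.trans_le h6) two_pos ?_ ?_ <;>
    exact max_le (by linarith) (by linarith)

lemma abs_discLogPotential_norm_sub_sub_le {x z : E2} {R : ℝ} (hR : 0 < R) (hx : ‖x‖ ≤ R) :
    |-discLogPotential R ‖x - z‖ - -Real.log (max ‖z‖ R)| ≤ 1 / 2 + Real.log 2 := by
  have h1 := abs_le.1 (abs_discLogPotential_sub_log_max_le (norm_nonneg (x - z)) hR)
  have h2 := abs_le.1 (abs_log_max_norm_sub_le (z := z) hR hx)
  rw [abs_le]
  constructor <;> linarith [h1.1, h1.2, h2.1, h2.2]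

lemma integrable_discLogPotential_norm_sub (z : E2) {R : ℝ} (hR : 0 < R) :
    Integrable (fun x => -discLogPotential R ‖x - z‖) (udisc 0 R) := by
  have := isProbabilityMeasure_udisc 0 hR
  have hm : Measurable fun x : E2 => -discLogPotential R ‖x - z‖ :=
    ((measurable_discLogPotential R).comp (by fun_prop)).neg
  refine Integrable.of_bound hm.aestronglyMeasurable
    (1 / 2 + Real.log 2 + |Real.log (max ‖z‖ R)|) ?_
  filter_upwards [ae_udisc_mem_closedBall 0 R] with x hx
  have h := abs_discLogPotential_norm_sub_sub_le (z := z) hR (by simpa using hx)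
  have h2 := abs_sub_abs_le_abs_sub (-discLogPotential R ‖x - z‖) (-Real.log (max ‖z‖ R))
  rw [abs_neg (Real.log _)] at h2
  rw [Real.norm_eq_abs]
  linarith

lemma abs_gsm_sub_le (z : E2) {R : ℝ} (hR : 0 < R) :
    |gsm R z - -Real.log (max ‖z‖ R)| ≤ 1 / 2 + Real.log 2 := by
  have := isProbabilityMeasure_udisc 0 hR
  have hconst : -Real.log (max ‖z‖ R) = ∫ _, -Real.log (max ‖z‖ R) ∂udisc (0 : E2) R := by
    simp
  rw [gsm_eq_integral z hR, hconst, ← integral_sub (integrable_discLogPotential_norm_sub z hR)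
    (integrable_const _)]
  exact abs_integral_udisc_le hR fun x hx => abs_discLogPotential_norm_sub_sub_le hR hx

/-- Up to a quadratic error, `discLogPotential 1` is `(a ^ 2 - 1) / 2` also outside the unit disc. -/
lemma abs_discLogPotential_one_sub_le (a : ℝ) (ha : 0 ≤ a) :
    |discLogPotential 1 a - (a ^ 2 - 1) / 2| ≤ (max 0 (a ^ 2 - 1)) ^ 2 / 2 := by
  unfold discLogPotential
  split_ifs with h
  · have : Real.log 1 - (1 - a ^ 2 / 1 ^ 2) / 2 - (a ^ 2 - 1) / 2 = 0 := by
      rw [Real.log_one]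
      ring
    rw [this, abs_zero]
    positivity
  · have h1 : 1 < a := not_le.1 h
    have hsq : 1 < a ^ 2 := by nlinarith
    have hlog : Real.log (a ^ 2) = 2 * Real.log a := by simp
    have hup := Real.log_le_sub_one_of_pos (x := a ^ 2) (by linarith)
    have hlow := Real.one_sub_inv_le_log_of_pos (x := a ^ 2) (by linarith)
    have hinv : a ^ 2 - 2 + (a ^ 2)⁻¹ ≤ (a ^ 2 - 1) ^ 2 := by
      have h3 : a ^ 2 - 2 + (a ^ 2)⁻¹ = (a ^ 2 - 1) ^ 2 / a ^ 2 := by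
        field_simp
        ring
      rw [h3]
      exact div_le_self (sq_nonneg _) hsq.le
    rw [max_eq_right (by linarith), abs_le]
    constructor <;> nlinarith

open scoped InnerProductSpace in
lemma integral_inner_udisc_zero (z : E2) {R : ℝ} (hR : 0 < R) :
    ∫ x, ⟪x, z⟫_ℝ ∂udisc 0 R = 0 := by
  have h := (Measure.measurePreserving_neg (volume : Measure E2)).setIntegral_preimage_emb
    (MeasurableEquiv.neg E2).measurableEmbedding (fun x => ⟪x, z⟫_ℝ) (closedBall 0 R)
  have hpre : Neg.neg ⁻¹' closedBall (0 : E2) R = closedBall 0 R := by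
    ext w
    simp
  rw [hpre] at h
  simp only [inner_neg_left, integral_neg] at h
  rw [integral_udisc_s16 _ _ hR, show ∫ x in closedBall (0 : E2) R, ⟪x, z⟫_ℝ = 0 by linarith,
    mul_zero]

open scoped InnerProductSpace in
lemma abs_discLogPotential_one_sub_sub_inner_le {x z : E2} (hx : ‖x‖ ≤ 1) (hz : ‖z‖ ≤ 1) :
    |-discLogPotential 1 ‖x - z‖ - -discLogPotential 1 ‖x - 0‖ - ⟪x, z⟫_ℝ| ≤ 5 * ‖z‖ ^ 2 := by
  have h1 := abs_discLogPotential_one_sub_le ‖x - z‖ (norm_nonneg _)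
  have h0 : discLogPotential 1 ‖x - 0‖ = (‖x‖ ^ 2 - 1) / 2 := by
    rw [sub_zero, discLogPotential, if_pos hx, Real.log_one]
    ring
  have hexp := norm_sub_sq_real x z
  have hin := abs_le.1 (abs_real_inner_le_norm x z)
  have hz0 := norm_nonneg z
  have hx0 := norm_nonneg x
  have hmul : ‖x‖ * ‖z‖ ≤ ‖z‖ := mul_le_of_le_one_left hz0 hx
  have hmax : max 0 (‖x - z‖ ^ 2 - 1) ≤ 3 * ‖z‖ := by
    refine max_le (by linarith) ?_
    nlinarith [hin.1]
  have hmax2 : (max 0 (‖x - z‖ ^ 2 - 1)) ^ 2 ≤ (3 * ‖z‖) ^ 2 := by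
    gcongr
  have h2 := abs_le.1 h1
  rw [h0, abs_le]
  constructor <;> nlinarith [h2.1, h2.2]

lemma abs_gsm_one_sub_kappa_le {z : E2} (hz : ‖z‖ ≤ 1) :
    |gsm 1 z - kappa| ≤ 5 * ‖z‖ ^ 2 := by
  have := isProbabilityMeasure_udisc 0 one_pos
  have hI : Integrable (fun x : E2 => inner ℝ x z) (udisc 0 1) := by
    refine Integrable.of_bound (by fun_prop) ‖z‖ ?_
    filter_upwards [ae_udisc_mem_closedBall 0 1] with x hx
    refine (norm_inner_le_norm x z).trans (mul_le_of_le_one_left (norm_nonneg z) ?_)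
    simpa using hx
  have hz1 := integrable_discLogPotential_norm_sub z one_pos
  have h01 := integrable_discLogPotential_norm_sub 0 one_pos
  have heq : gsm 1 z - kappa =
      ∫ x, (-discLogPotential 1 ‖x - z‖ - -discLogPotential 1 ‖x - 0‖ - inner ℝ x z)
        ∂udisc 0 1 := by
    rw [integral_sub (by exact hz1.sub h01) hI, integral_sub hz1 h01,
      integral_inner_udisc_zero z one_pos, sub_zero, kappa, gsm_eq_integral z one_pos,
      gsm_eq_integral 0 one_pos]
  rw [heq]
  exact abs_integral_udisc_le one_pos fun x hx =>
    abs_discLogPotential_one_sub_sub_inner_le hx hz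

end

/-- Estimates on `g_lam`: comparison with `g(max(|z|, lam))`, and quadratic expansion of
`g_1` near `0` (equations (2.6)–(2.7)). -/
theorem statement16 :
    ∃ C : ℝ, 0 < C ∧
      (∀ lam : ℝ, 0 < lam → ∀ z : E2,
        |gsm lam z - (-Real.log (max ‖z‖ lam))| ≤ C) ∧
      (∀ z : E2, ‖z‖ ≤ 1 → |gsm 1 z - kappa| ≤ C * ‖z‖ ^ 2) := by
  refine ⟨5, by norm_num, fun lam hlam z => (abs_gsm_sub_le z hlam).trans ?_,
    fun z hz => abs_gsm_one_sub_kappa_le hz⟩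
  linarith [Real.log_two_lt_d9]
end
end
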